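/- arXiv:2010.13135 — 2 statements merged into one kernel-verified Lean document; each statement's English description precedes it below -/
import Mathlib

section
/- For every integer k ≥ 1, the triangle with vertices (0,0), (1,3), and (2k+2,1) has exactly three boundary lattice points (namely its vertices), has exactly 3k+2 interior lattice points, and contains (1,1), (1,2), and (2,1) among its interior lattice points; in particular its interior lattice points are not all collinear. -/
/-- A point of `ℝ × ℝ` is a lattice point if both coordinates are integers. -/
def LatticePt (p : ℝ × ℝ) : Prop := ∃ m n : ℤ, p = ((m : ℝ), (n : ℝ))

/-- The lattice points lying in a subset of the plane. -/
def latticePts (S : Set (ℝ × ℝ)) : Set (ℝ × ℝ) := {p | p ∈ S ∧ LatticePt p}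

/-- The interior of a closed half-plane is the corresponding open half-plane. -/
theorem interior_halfPlane (a b d : ℝ) (hab : 0 < a ^ 2 + b ^ 2) :
    interior {p : ℝ × ℝ | 0 ≤ a * p.1 + b * p.2 + d} = {p | 0 < a * p.1 + b * p.2 + d} := by
  refine Set.Subset.antisymm (fun p hp => ?_) ?_
  · have hcont : Continuous fun t : ℝ => (p.1 - t * a, p.2 - t * b) := by fun_prop
    have hmem : ∀ᶠ t in nhds (0 : ℝ), 0 ≤ a * (p.1 - t * a) + b * (p.2 - t * b) + d := by
      refine hcont.continuousAt.eventually (p := fun q : ℝ × ℝ => 0 ≤ a * q.1 + b * q.2 + d) ?_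
      simp only [zero_mul, sub_zero]
      filter_upwards [mem_interior_iff_mem_nhds.1 hp] with q hq using hq
    obtain ⟨ε, hε, hball⟩ := Metric.eventually_nhds_iff.1 hmem
    have h := hball (y := ε / 2) (by rw [Real.dist_eq, sub_zero, abs_of_pos] <;> linarith)
    have := mul_pos (half_pos hε) hab
    simp only [Set.mem_ofPred_eq]
    linarith
  · refine interior_maximal (fun p (hp : 0 < a * p.1 + b * p.2 + d) => hp.le) ?_
    exact isOpen_lt continuous_const (by fun_prop)

/-- The triangle with vertices `(0,0)`, `(1,3)`, `(c,1)` as an intersection of half-planes. -/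
theorem convexHull_triangle_eq (c : ℝ) (hc : 1 < c) :
    convexHull ℝ ({((0:ℝ), (0:ℝ)), ((1:ℝ), (3:ℝ)), (c, (1:ℝ))} : Set (ℝ × ℝ)) =
      {p | 0 ≤ (-1) * p.1 + c * p.2 + 0} ∩ ({p | 0 ≤ 3 * p.1 + (-1) * p.2 + 0} ∩
        {p | 0 ≤ (-2) * p.1 + (1 - c) * p.2 + (3 * c - 1)}) := by
  have hD : 0 < 3 * c - 1 := by linarith
  rw [convexHull_insert (by simp), convexHull_pair]
  ext ⟨x, y⟩
  simp only [mem_convexJoin, Set.mem_singleton_iff, exists_eq_left, Set.mem_inter_iff,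
    Set.mem_ofPred_eq]
  constructor
  · rintro ⟨q, ⟨s, t, hs, ht, hst, rfl⟩, ⟨u, v, hu, hv, huv, h⟩⟩
    obtain rfl : s = 1 - t := by linarith
    obtain rfl : u = 1 - v := by linarith
    simp only [Prod.smul_mk, Prod.mk_add_mk, smul_eq_mul, Prod.mk.injEq] at h
    obtain ⟨rfl, rfl⟩ := h
    have h1 := mul_nonneg (mul_nonneg hv hs) hD.le
    have h2 := mul_nonneg (mul_nonneg hv ht) hD.le
    have h3 := mul_nonneg hu hD.le
    refine ⟨?_, ?_, ?_⟩ <;> linarith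
  · rintro ⟨h1, h2, h3⟩
    have hS : 0 ≤ (c * y - x) + (3 * x - y) := by linarith
    rcases hS.eq_or_lt with hS | hS
    · have hy : y = 0 := by
        have : (3 * c - 1) * y = 0 := by linarith
        exact (mul_eq_zero.1 this).resolve_left hD.ne'
      subst hy
      have hx : x = 0 := by linarith
      subst hx
      exact ⟨(1, 3), left_mem_segment _ _ _, left_mem_segment _ _ _⟩
    · have hS' := hS.ne'
      have hD' := hD.ne'
      refine ⟨(((c * y - x) + (3 * x - y) * c) / ((c * y - x) + (3 * x - y)),
        ((c * y - x) * 3 + (3 * x - y)) / ((c * y - x) + (3 * x - y))),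
        ⟨(c * y - x) / ((c * y - x) + (3 * x - y)), (3 * x - y) / ((c * y - x) + (3 * x - y)),
          div_nonneg (by linarith) hS.le, div_nonneg (by linarith) hS.le, ?_, ?_⟩,
        ⟨1 - ((c * y - x) + (3 * x - y)) / (3 * c - 1), ((c * y - x) + (3 * x - y)) / (3 * c - 1),
          ?_, div_nonneg hS.le hD.le, by ring, ?_⟩⟩
      · rw [← add_div, div_self hS']
      · ext <;> simp <;> ring
      · rw [sub_nonneg, div_le_one hD]
        linarith
      · ext
        · simp only [Prod.smul_mk, Prod.mk_add_mk, smul_eq_mul]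
          rw [mul_zero, zero_add, div_mul_div_comm, mul_comm (3 * c - 1),
            mul_div_mul_left _ _ hS', div_eq_iff hD']
          ring
        · simp only [Prod.smul_mk, Prod.mk_add_mk, smul_eq_mul]
          rw [mul_zero, zero_add, div_mul_div_comm, mul_comm (3 * c - 1),
            mul_div_mul_left _ _ hS', div_eq_iff hD']
          ring

theorem interior_triangle_eq (c : ℝ) (hc : 1 < c) :
    interior (convexHull ℝ ({((0:ℝ), (0:ℝ)), ((1:ℝ), (3:ℝ)), (c, (1:ℝ))} : Set (ℝ × ℝ))) =
      {p | 0 < (-1) * p.1 + c * p.2 + 0} ∩ ({p | 0 < 3 * p.1 + (-1) * p.2 + 0} ∩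
        {p | 0 < (-2) * p.1 + (1 - c) * p.2 + (3 * c - 1)}) := by
  rw [convexHull_triangle_eq c hc, interior_inter, interior_inter,
    interior_halfPlane _ _ _ (by positivity), interior_halfPlane _ _ _ (by positivity),
    interior_halfPlane _ _ _ (by positivity)]

theorem intCast_mem_triangle_iff (k : ℤ) (hk : 1 ≤ k) (m n : ℤ) :
    ((m : ℝ), (n : ℝ)) ∈ convexHull ℝ ({((0:ℝ), (0:ℝ)), ((1:ℝ), (3:ℝ)),
      (((2*k+2 : ℤ) : ℝ), (1:ℝ))} : Set (ℝ × ℝ)) ↔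
    0 ≤ (2 * k + 2) * n - m ∧ 0 ≤ 3 * m - n ∧ 0 ≤ 6 * k + 5 - 2 * m - (2 * k + 1) * n := by
  rw [convexHull_triangle_eq _ (by exact_mod_cast (by omega : (1 : ℤ) < 2 * k + 2))]
  simp only [Set.mem_inter_iff, Set.mem_ofPred_eq]
  rw [← Int.cast_nonneg_iff (R := ℝ), ← Int.cast_nonneg_iff (R := ℝ),
    ← Int.cast_nonneg_iff (R := ℝ)]
  push_cast
  ring_nf

theorem intCast_mem_interior_triangle_iff (k : ℤ) (hk : 1 ≤ k) (m n : ℤ) :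
    ((m : ℝ), (n : ℝ)) ∈ interior (convexHull ℝ ({((0:ℝ), (0:ℝ)), ((1:ℝ), (3:ℝ)),
      (((2*k+2 : ℤ) : ℝ), (1:ℝ))} : Set (ℝ × ℝ))) ↔
    0 < (2 * k + 2) * n - m ∧ 0 < 3 * m - n ∧ 0 < 6 * k + 5 - 2 * m - (2 * k + 1) * n := by
  rw [interior_triangle_eq _ (by exact_mod_cast (by omega : (1 : ℤ) < 2 * k + 2))]
  simp only [Set.mem_inter_iff, Set.mem_ofPred_eq]
  rw [← Int.cast_pos (R := ℝ), ← Int.cast_pos (R := ℝ),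
    ← Int.cast_pos (R := ℝ)]
  push_cast
  ring_nf

/-- The second coordinate of a lattice point of the triangle lies between `0` and `3`. -/
theorem snd_mem_Icc_of_triangle {k m n : ℤ} (hk : 1 ≤ k) (h1 : 0 ≤ (2 * k + 2) * n - m)
    (h2 : 0 ≤ 3 * m - n) (h3 : 0 ≤ 6 * k + 5 - 2 * m - (2 * k + 1) * n) : 0 ≤ n ∧ n ≤ 3 := by
  have hD : 0 < 6 * k + 5 := by omega
  constructor
  · refine nonneg_of_mul_nonneg_right (a := 6 * k + 5) ?_ hD
    linarith
  · refine sub_nonneg.1 (nonneg_of_mul_nonneg_right (a := 6 * k + 5) ?_ hD)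
    linarith

theorem latticePts_frontier_triangle (k : ℤ) (hk : 1 ≤ k) :
    latticePts (frontier (convexHull ℝ ({((0:ℝ), (0:ℝ)), ((1:ℝ), (3:ℝ)),
      (((2*k+2 : ℤ) : ℝ), (1:ℝ))} : Set (ℝ × ℝ)))) = ({((0:ℝ), (0:ℝ)), ((1:ℝ), (3:ℝ)),
      (((2*k+2 : ℤ) : ℝ), (1:ℝ))} : Set (ℝ × ℝ)) := by
  have hclosed : IsClosed (convexHull ℝ ({((0:ℝ), (0:ℝ)), ((1:ℝ), (3:ℝ)),
      (((2*k+2 : ℤ) : ℝ), (1:ℝ))} : Set (ℝ × ℝ))) :=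
    (Set.toFinite _).isClosed_convexHull ℝ
  rw [hclosed.frontier_eq]
  have key (m n : ℤ) := (intCast_mem_triangle_iff k hk m n).and
    (not_congr (intCast_mem_interior_triangle_iff k hk m n))
  ext p
  constructor
  · rintro ⟨hp, m, n, rfl⟩
    obtain ⟨⟨h1, h2, h3⟩, h4⟩ := (key m n).1 hp
    obtain ⟨hn0, hn3⟩ := snd_mem_Icc_of_triangle hk h1 h2 h3
    have : (m = 0 ∧ n = 0) ∨ (m = 1 ∧ n = 3) ∨ (m = 2 * k + 2 ∧ n = 1) := by
      interval_cases n <;> omega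
    rcases this with ⟨rfl, rfl⟩ | ⟨rfl, rfl⟩ | ⟨rfl, rfl⟩ <;> simp
  · rintro (rfl | rfl | rfl)
    · exact ⟨by simpa using (key 0 0).2 (by omega), 0, 0, by simp⟩
    · exact ⟨by simpa using (key 1 3).2 (by omega), 1, 3, by simp⟩
    · exact ⟨by simpa using (key (2 * k + 2) 1).2 (by omega), 2 * k + 2, 1, by simp⟩

theorem latticePts_interior_triangle (k : ℤ) (hk : 1 ≤ k) :
    latticePts (interior (convexHull ℝ ({((0:ℝ), (0:ℝ)), ((1:ℝ), (3:ℝ)),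
      (((2*k+2 : ℤ) : ℝ), (1:ℝ))} : Set (ℝ × ℝ)))) =
    (fun q : ℤ × ℤ => ((q.1 : ℝ), (q.2 : ℝ))) ''
      ((Finset.Icc 1 (2 * k + 1) ×ˢ {1} ∪ Finset.Icc 1 (k + 1) ×ˢ {2} : Finset (ℤ × ℤ)) :
        Set (ℤ × ℤ)) := by
  have hiff (m n : ℤ) : ((m : ℝ), (n : ℝ)) ∈ interior (convexHull ℝ ({((0:ℝ), (0:ℝ)),
      ((1:ℝ), (3:ℝ)), (((2*k+2 : ℤ) : ℝ), (1:ℝ))} : Set (ℝ × ℝ))) ↔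
      (m, n) ∈ (Finset.Icc 1 (2 * k + 1) ×ˢ {1} ∪ Finset.Icc 1 (k + 1) ×ˢ {2} :
        Finset (ℤ × ℤ)) := by
    rw [intCast_mem_interior_triangle_iff k hk]
    simp only [Finset.mem_union, Finset.mem_product, Finset.mem_Icc, Finset.mem_singleton]
    constructor
    · rintro ⟨h1, h2, h3⟩
      obtain ⟨hn0, hn3⟩ := snd_mem_Icc_of_triangle hk h1.le h2.le h3.le
      interval_cases n <;> omega
    · rintro (⟨h, rfl⟩ | ⟨h, rfl⟩) <;> omega
  ext p
  constructor
  · rintro ⟨hp, m, n, rfl⟩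
    exact ⟨(m, n), (hiff m n).1 hp, rfl⟩
  · rintro ⟨⟨m, n⟩, hq, rfl⟩
    exact ⟨(hiff m n).2 hq, m, n, rfl⟩

theorem ncard_latticePts_interior_triangle (k : ℤ) (hk : 1 ≤ k) :
    ((latticePts (interior (convexHull ℝ ({((0:ℝ), (0:ℝ)), ((1:ℝ), (3:ℝ)),
      (((2*k+2 : ℤ) : ℝ), (1:ℝ))} : Set (ℝ × ℝ))))).ncard : ℤ) = 3 * k + 2 := by
  have hinj : Function.Injective fun q : ℤ × ℤ => ((q.1 : ℝ), (q.2 : ℝ)) := by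
    rintro ⟨a, b⟩ ⟨a', b'⟩ h
    simpa using h
  rw [latticePts_interior_triangle k hk, Set.ncard_image_of_injective _ hinj,
    Set.ncard_coe_finset, Finset.card_union_of_disjoint]
  · simp only [Finset.card_product, Int.card_Icc, Finset.card_singleton]
    omega
  · rw [Finset.disjoint_left]
    rintro ⟨m, n⟩ h h'
    simp only [Finset.mem_product, Finset.mem_singleton] at h h'
    omega

/-- For every integer `k ≥ 1`, the triangle with vertices `(0,0)`, `(1,3)`, `(2k+2,1)`
has exactly three boundary lattice points (namely its vertices), exactly `3k+2` interior
lattice points, and contains `(1,1)`, `(1,2)`, `(2,1)` among its interior lattice points;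
in particular its interior lattice points are not all collinear. -/
theorem stmt2 (k : ℤ) (hk : 1 ≤ k)
    (T : Set (ℝ × ℝ))
    (hT : T = convexHull ℝ ({((0:ℝ), (0:ℝ)), ((1:ℝ), (3:ℝ)),
      (((2*k+2 : ℤ) : ℝ), (1:ℝ))} : Set (ℝ × ℝ))) :
    (latticePts (frontier T)).ncard = 3 ∧
    latticePts (frontier T) = ({((0:ℝ), (0:ℝ)), ((1:ℝ), (3:ℝ)),
      (((2*k+2 : ℤ) : ℝ), (1:ℝ))} : Set (ℝ × ℝ)) ∧
    ((latticePts (interior T)).ncard : ℤ) = 3 * k + 2 ∧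
    ((1:ℝ), (1:ℝ)) ∈ latticePts (interior T) ∧
    ((1:ℝ), (2:ℝ)) ∈ latticePts (interior T) ∧
    ((2:ℝ), (1:ℝ)) ∈ latticePts (interior T) ∧
    ¬ Collinear ℝ (latticePts (interior T)) := by
  subst hT
  have hmem (m n : ℤ) (h : 0 < (2 * k + 2) * n - m ∧ 0 < 3 * m - n ∧
      0 < 6 * k + 5 - 2 * m - (2 * k + 1) * n) :
      ((m : ℝ), (n : ℝ)) ∈ latticePts (interior (convexHull ℝ ({((0:ℝ), (0:ℝ)),
        ((1:ℝ), (3:ℝ)), (((2*k+2 : ℤ) : ℝ), (1:ℝ))} : Set (ℝ × ℝ)))) :=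
    ⟨(intCast_mem_interior_triangle_iff k hk m n).2 h, m, n, rfl⟩
  have h11 := hmem 1 1 (by omega)
  have h12 := hmem 1 2 (by omega)
  have h21 := hmem 2 1 (by omega)
  simp only [Int.cast_one, Int.cast_ofNat] at h11 h12 h21
  refine ⟨?_, latticePts_frontier_triangle k hk, ncard_latticePts_interior_triangle k hk,
    h11, h12, h21, fun hcol => ?_⟩
  · rw [latticePts_frontier_triangle k hk, Set.ncard_eq_three]
    exact ⟨_, _, _, by simp, by simp, by simp, rfl⟩
  · obtain ⟨v, hv⟩ := (collinear_iff_of_mem h11).1 hcol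
    obtain ⟨r, hr⟩ := hv _ h12
    obtain ⟨s, hs⟩ := hv _ h21
    simp only [vadd_eq_add, Prod.ext_iff, Prod.fst_add, Prod.snd_add, Prod.smul_fst,
      Prod.smul_snd, smul_eq_mul] at hr hs
    have hr1 : r * v.1 = 0 := by linarith [hr.1]
    have hr2 : r * v.2 = 1 := by linarith [hr.2]
    have hs1 : s * v.1 = 1 := by linarith [hs.1]
    rcases mul_eq_zero.1 hr1 with h | h
    · simp [h] at hr2
    · simp [h] at hs1
end

section
/- Every lattice triangle with exactly three boundary lattice points and exactly 7 interior lattice points has all of its interior lattice points collinear. -/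
/-- A subset of a line `a x + b y = c` is collinear. -/
theorem collinear_of_linear_eq {S : Set (ℝ × ℝ)} {a b c : ℝ} (hab : a ≠ 0 ∨ b ≠ 0)
    (h : ∀ z ∈ S, a * z.1 + b * z.2 = c) : Collinear ℝ S := by
  have hpos : a ^ 2 + b ^ 2 ≠ 0 := by
    rcases hab with ha | hb
    · have := sq_nonneg b
      positivity
    · have := sq_nonneg a
      positivity
  rw [collinear_iff_exists_forall_eq_smul_vadd]
  refine ⟨(c * a / (a ^ 2 + b ^ 2), c * b / (a ^ 2 + b ^ 2)), (-b, a), fun z hz => ?_⟩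
  refine ⟨(a * z.2 - b * z.1) / (a ^ 2 + b ^ 2), ?_⟩
  have := h z hz
  ext
  · simp only [vadd_eq_add, Prod.smul_mk, smul_eq_mul, Prod.mk_add_mk]
    field_simp
    rw [← this]
    ring
  · simp only [vadd_eq_add, Prod.smul_mk, smul_eq_mul, Prod.mk_add_mk]
    field_simp
    rw [← this]
    ring

/-- Twice the signed area of the parallelogram spanned by `p, z` and `p, w`. -/
def area (p z w : ℝ × ℝ) : ℝ := (z.1 - p.1) * (w.2 - p.2) - (z.2 - p.2) * (w.1 - p.1)

/-- The affine basis of the plane given by the vertices of a nondegenerate triangle. -/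
noncomputable def triangleBasis (p q r : ℝ × ℝ)
    (h : ¬ Collinear ℝ ({p, q, r} : Set (ℝ × ℝ))) : AffineBasis (Fin 3) ℝ (ℝ × ℝ) :=
  ⟨![p, q, r], affineIndependent_iff_not_collinear_set.2 h, by
    rw [(affineIndependent_iff_not_collinear_set.2 h).affineSpan_eq_top_iff_card_eq_finrank_add_one]
    simp⟩

theorem triangleBasis_range (p q r : ℝ × ℝ) (h : ¬ Collinear ℝ ({p, q, r} : Set (ℝ × ℝ))) :
    Set.range (triangleBasis p q r h) = {p, q, r} := by
  change Set.range ![p, q, r] = _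
  rw [Matrix.range_cons, Matrix.range_cons_cons_empty, Set.singleton_union]

theorem triangleBasis_coord (p q r : ℝ × ℝ) (h : ¬ Collinear ℝ ({p, q, r} : Set (ℝ × ℝ)))
    (z : ℝ × ℝ) :
    (triangleBasis p q r h).coord 1 z * area p q r = area p z r ∧
    (triangleBasis p q r h).coord 2 z * area p q r = area p q z ∧
    (triangleBasis p q r h).coord 0 z * area p q r = area p q r - area p z r - area p q z := by
  have h1 := (triangleBasis p q r h).sum_coord_apply_eq_one z
  have h2 := (triangleBasis p q r h).linear_combination_coord_eq_self z
  have e0 : triangleBasis p q r h 0 = p := rfl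
  have e1 : triangleBasis p q r h 1 = q := rfl
  have e2 : triangleBasis p q r h 2 = r := rfl
  rw [Fin.sum_univ_three] at h1 h2
  rw [e0, e1, e2] at h2
  generalize (triangleBasis p q r h).coord 0 z = a at *
  generalize (triangleBasis p q r h).coord 1 z = b at *
  generalize (triangleBasis p q r h).coord 2 z = c at *
  obtain rfl : a = 1 - b - c := by linarith
  subst h2
  simp only [area, Prod.fst_add, Prod.snd_add, Prod.smul_fst, Prod.smul_snd, smul_eq_mul]
  refine ⟨?_, ?_, ?_⟩ <;> ring

theorem mem_triangle_iff {p q r : ℝ × ℝ} (h : ¬ Collinear ℝ ({p, q, r} : Set (ℝ × ℝ)))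
    (hD : 0 < area p q r) (z : ℝ × ℝ) :
    z ∈ convexHull ℝ ({p, q, r} : Set (ℝ × ℝ)) ↔
      0 ≤ area p z r ∧ 0 ≤ area p q z ∧ area p z r + area p q z ≤ area p q r := by
  obtain ⟨h1, h2, h0⟩ := triangleBasis_coord p q r h z
  rw [← triangleBasis_range p q r h, AffineBasis.convexHull_eq_nonneg_coord, Set.mem_ofPred_eq,
    Fin.forall_fin_succ, Fin.forall_fin_two]
  change 0 ≤ (triangleBasis p q r h).coord 0 z ∧ 0 ≤ (triangleBasis p q r h).coord 1 z ∧
    0 ≤ (triangleBasis p q r h).coord 2 z ↔ _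
  rw [← mul_nonneg_iff_of_pos_right hD, ← mul_nonneg_iff_of_pos_right (b := AffineBasis.coord _ 1 z) hD,
    ← mul_nonneg_iff_of_pos_right (b := AffineBasis.coord _ 2 z) hD, h0, h1, h2]
  constructor <;> rintro ⟨_, _, _⟩ <;> refine ⟨?_, ?_, ?_⟩ <;> linarith

theorem mem_interior_triangle_iff {p q r : ℝ × ℝ}
    (h : ¬ Collinear ℝ ({p, q, r} : Set (ℝ × ℝ))) (hD : 0 < area p q r) (z : ℝ × ℝ) :
    z ∈ interior (convexHull ℝ ({p, q, r} : Set (ℝ × ℝ))) ↔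
      0 < area p z r ∧ 0 < area p q z ∧ area p z r + area p q z < area p q r := by
  obtain ⟨h1, h2, h0⟩ := triangleBasis_coord p q r h z
  rw [← triangleBasis_range p q r h, AffineBasis.interior_convexHull, Set.mem_ofPred_eq,
    Fin.forall_fin_succ, Fin.forall_fin_two]
  change 0 < (triangleBasis p q r h).coord 0 z ∧ 0 < (triangleBasis p q r h).coord 1 z ∧
    0 < (triangleBasis p q r h).coord 2 z ↔ _
  rw [← mul_pos_iff_of_pos_right hD, ← mul_pos_iff_of_pos_right (a := AffineBasis.coord _ 1 z) hD,
    ← mul_pos_iff_of_pos_right (a := AffineBasis.coord _ 2 z) hD, h0, h1, h2]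
  constructor <;> rintro ⟨_, _, _⟩ <;> refine ⟨?_, ?_, ?_⟩ <;> linarith

/-- If `k` and `k - 1` are coprime to `D`, the residues `y` modulo `D` for which the
representative of `-k y` plus `y` stays below `D` make up half of the nonzero ones. -/
theorem two_mul_card_residues {D k : ℤ} (hD : 0 < D) (hk : IsCoprime k D)
    (hk1 : IsCoprime (k - 1) D) :
    2 * (((Finset.Ioo 0 D).filter fun y => (-k * y) % D + y < D).card : ℤ) + 1 = D := by
  have hnd : ∀ y, 0 < y → y < D → ¬ D ∣ y := fun y h0 h1 h =>
    absurd (Int.le_of_dvd h0 h) (by omega)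
  have hflip : ((Finset.Ioo 0 D).filter fun y => (-k * y) % D + y < D).card =
      ((Finset.Ioo 0 D).filter fun y => ¬ (-k * y) % D + y < D).card := by
    have key : ∀ y, 0 < y → y < D → (-k * (D - y)) % D = D - (-k * y) % D ∧
        (-k * y) % D + y ≠ D := by
      intro y h0 h1
      have hdm := Int.emod_add_mul_ediv (-k * y) D
      have hlo := Int.emod_nonneg (-k * y) hD.ne'
      have hhi := Int.emod_lt_of_pos (-k * y) hD
      have hne : (-k * y) % D ≠ 0 := by
        intro h
        have h2 : D ∣ k * y := by
          have := Int.dvd_of_emod_eq_zero h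
          rwa [neg_mul, dvd_neg] at this
        exact hnd y h0 h1 (hk.symm.dvd_of_dvd_mul_left h2)
      generalize (-k * y) / D = e at *
      generalize (-k * y) % D = s at *
      refine ⟨?_, fun hs => ?_⟩
      · have : -k * (D - y) = (D - s) + D * (-k - e - 1) := by linear_combination hdm
        rw [this, Int.add_mul_emod_self_left, Int.emod_eq_of_lt (by omega) (by omega)]
      · refine hnd y h0 h1 (hk1.symm.dvd_of_dvd_mul_left ⟨-1 - e, ?_⟩)
        linear_combination hdm - hs
    refine Finset.card_bij' (fun y _ => D - y) (fun y _ => D - y) ?_ ?_ ?_ ?_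
    · intro y hy
      simp only [Finset.mem_filter, Finset.mem_Ioo] at hy ⊢
      obtain ⟨h, h'⟩ := key y hy.1.1 hy.1.2
      rw [h]
      omega
    · intro y hy
      simp only [Finset.mem_filter, Finset.mem_Ioo] at hy ⊢
      obtain ⟨h, h'⟩ := key y hy.1.1 hy.1.2
      rw [h]
      omega
    · intro y _
      ring
    · intro y _
      ring
  have hsum := Finset.card_filter_add_card_filter_not (s := Finset.Ioo 0 D)
    (fun y => (-k * y) % D + y < D)
  rw [Int.card_Ioo] at hsum
  omega

/-- A lattice segment from the origin is primitive if it has no lattice points besides its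
endpoints. -/
theorem isCoprime_of_primitive {m n : ℤ} (h0 : m ≠ 0 ∨ n ≠ 0)
    (h : ∀ g x y : ℤ, 0 < g → m = g * x → n = g * y → g = 1) : IsCoprime m n := by
  rw [Int.isCoprime_iff_gcd_eq_one]
  obtain ⟨x, hx⟩ := Int.gcd_dvd_left m n
  obtain ⟨y, hy⟩ := Int.gcd_dvd_right m n
  have hpos : 0 < m.gcd n := by
    rw [Int.gcd_pos_iff]
    exact h0
  exact_mod_cast h (m.gcd n) x y (by exact_mod_cast hpos) hx hy

/-- The integer points of a triangle `0, u, v` with no boundary points but the vertices and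
with `7` interior points lie on one of the three medians. -/
theorem lattice_triangle_median {u₁ u₂ v₁ v₂ D : ℤ} (hDef : D = u₁ * v₂ - u₂ * v₁) (hD : 0 < D)
    (hbd : ∀ x y : ℤ, 0 ≤ x * v₂ - y * v₁ → 0 ≤ u₁ * y - u₂ * x →
      x * v₂ - y * v₁ + (u₁ * y - u₂ * x) ≤ D →
      (x * v₂ - y * v₁ = 0 ∨ u₁ * y - u₂ * x = 0 ∨ x * v₂ - y * v₁ + (u₁ * y - u₂ * x) = D) →
      (x = 0 ∧ y = 0) ∨ (x = u₁ ∧ y = u₂) ∨ (x = v₁ ∧ y = v₂))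
    (hint : {z : ℤ × ℤ | 0 < z.1 * v₂ - z.2 * v₁ ∧ 0 < u₁ * z.2 - u₂ * z.1 ∧
      z.1 * v₂ - z.2 * v₁ + (u₁ * z.2 - u₂ * z.1) < D}.ncard = 7) :
    ∃ a b c : ℤ, (a ≠ 0 ∨ b ≠ 0) ∧ ∀ x y : ℤ, 0 < x * v₂ - y * v₁ → 0 < u₁ * y - u₂ * x →
      x * v₂ - y * v₁ + (u₁ * y - u₂ * x) < D →
      a * (x * v₂ - y * v₁) + b * (u₁ * y - u₂ * x) = c := by
  have hu : IsCoprime u₁ u₂ := by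
    refine isCoprime_of_primitive ?_ fun g x y hg hx hy => ?_
    · by_contra! h
      simp [hDef, h.1, h.2] at hD
    · have hA : D = g * (x * v₂ - y * v₁) := by rw [hDef, hx, hy]; ring
      have hApos : 0 < x * v₂ - y * v₁ := by
        rw [hA] at hD
        exact pos_of_mul_pos_right hD hg.le
      have hB : u₁ * y - u₂ * x = 0 := by rw [hx, hy]; ring
      rcases hbd x y hApos.le hB.ge (by rw [hB]; nlinarith) (Or.inr (Or.inl hB)) with
        ⟨rfl, rfl⟩ | ⟨rfl, rfl⟩ | ⟨rfl, rfl⟩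
      · simp at hApos
      · rw [← hDef] at hA hApos
        nlinarith
      · linarith [hApos, mul_comm x y]
  have hv : IsCoprime v₁ v₂ := by
    refine isCoprime_of_primitive ?_ fun g x y hg hx hy => ?_
    · by_contra! h
      simp [hDef, h.1, h.2] at hD
    · have hA : D = g * (u₁ * y - u₂ * x) := by rw [hDef, hx, hy]; ring
      have hApos : 0 < u₁ * y - u₂ * x := by
        rw [hA] at hD
        exact pos_of_mul_pos_right hD hg.le
      have hB : x * v₂ - y * v₁ = 0 := by rw [hx, hy]; ring
      rcases hbd x y hB.ge hApos.le (by rw [hB]; nlinarith) (Or.inl hB) with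
        ⟨rfl, rfl⟩ | ⟨rfl, rfl⟩ | ⟨rfl, rfl⟩
      · simp at hApos
      · linarith [hApos, mul_comm x y]
      · rw [← hDef] at hA hApos
        nlinarith
  have hw : IsCoprime (v₁ - u₁) (v₂ - u₂) := by
    refine isCoprime_of_primitive ?_ fun g x y hg hx hy => ?_
    · by_contra! h
      have h1 : v₁ = u₁ := by linarith [h.1]
      have h2 : v₂ = u₂ := by linarith [h.2]
      rw [hDef, h1, h2] at hD
      linarith [mul_comm u₁ u₂]
    · have hA : D = g * (u₁ * y - u₂ * x) := by
        rw [hDef]; linear_combination u₁ * hy - u₂ * hx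
      have hApos : 0 < u₁ * y - u₂ * x := by
        have := hD
        rw [hA] at this
        exact pos_of_mul_pos_right this hg.le
      have hE : (u₁ + x) * v₂ - (u₂ + y) * v₁ + (u₁ * (u₂ + y) - u₂ * (u₁ + x)) = D := by
        have h1 : v₁ = u₁ + g * x := by linarith
        have h2 : v₂ = u₂ + g * y := by linarith
        rw [hDef, h1, h2]; ring
      have hB : u₁ * (u₂ + y) - u₂ * (u₁ + x) = u₁ * y - u₂ * x := by ring
      have hle : u₁ * y - u₂ * x ≤ D := by nlinarith
      rcases hbd (u₁ + x) (u₂ + y) (by linarith) (by linarith) hE.le (Or.inr (Or.inr hE)) with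
        ⟨h1, h2⟩ | ⟨h1, h2⟩ | ⟨h1, h2⟩
      · rw [h1, h2] at hB
        linarith
      · rw [h1, h2] at hB
        linarith [mul_comm u₁ u₂]
      · rw [h1, h2, ← hDef] at hB
        rw [← hB] at hA
        nlinarith
  obtain ⟨α, β, hαβ⟩ := hu
  set k := α * v₁ + β * v₂ with hk
  have hv1 : v₁ = k * u₁ - D * β := by rw [hk, hDef]; linear_combination -v₁ * hαβ
  have hv2 : v₂ = k * u₂ + D * α := by rw [hk, hDef]; linear_combination -v₂ * hαβ
  have hkD : IsCoprime k D := by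
    obtain ⟨s, t, hst⟩ := hv
    refine ⟨s * u₁ + t * u₂, -s * β + t * α, ?_⟩
    linear_combination hst - s * hv1 - t * hv2
  have hkD1 : IsCoprime (k - 1) D := by
    obtain ⟨s, t, hst⟩ := hw
    refine ⟨s * u₁ + t * u₂, -s * β + t * α, ?_⟩
    linear_combination hst - s * hv1 - t * hv2
  have hA : ∀ x y : ℤ, x * v₂ - y * v₁ = D * (α * x + β * y) - k * (u₁ * y - u₂ * x) := by
    intro x y
    linear_combination x * hv2 - y * hv1
  have hcard := two_mul_card_residues hD hkD hkD1
  have hbij : {z : ℤ × ℤ | 0 < z.1 * v₂ - z.2 * v₁ ∧ 0 < u₁ * z.2 - u₂ * z.1 ∧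
      z.1 * v₂ - z.2 * v₁ + (u₁ * z.2 - u₂ * z.1) < D}.ncard =
      ((Finset.Ioo 0 D).filter fun y => (-k * y) % D + y < D).card := by
    have hmod : ∀ X Y : ℤ, 0 < D * X - k * Y → D * X - k * Y < D →
        (-k * Y) % D = D * X - k * Y := by
      intro X Y h0 h1
      rw [show -k * Y = (D * X - k * Y) + D * (-X) by ring, Int.add_mul_emod_self_left,
        Int.emod_eq_of_lt h0.le h1]
    rw [← Set.ncard_coe_finset]
    refine Set.ncard_congr (fun z _ => u₁ * z.2 - u₂ * z.1) ?_ ?_ ?_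
    · rintro ⟨x, y⟩ ⟨h1, h2, h3⟩
      simp only at h1 h2 h3
      rw [hA] at h1 h3
      simp only [Finset.coe_filter, Finset.mem_Ioo, Set.mem_ofPred_eq]
      rw [hmod (α * x + β * y) _ h1 (by linarith)]
      exact ⟨⟨h2, by linarith⟩, h3⟩
    · rintro ⟨x, y⟩ ⟨x', y'⟩ ⟨h1, h2, h3⟩ ⟨h1', h2', h3'⟩ he
      simp only at h1 h2 h3 h1' h2' h3' he
      rw [hA] at h1 h3 h1' h3'
      have e1 := hmod (α * x + β * y) _ h1 (by linarith)
      have e2 := hmod (α * x' + β * y') _ h1' (by linarith)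
      rw [he] at e1
      have e3 : α * x + β * y = α * x' + β * y' := by
        have : D * (α * x + β * y) = D * (α * x' + β * y') := by linarith
        exact mul_left_cancel₀ hD.ne' this
      ext
      · linear_combination u₁ * e3 - β * he - (x - x') * hαβ
      · linear_combination u₂ * e3 + α * he - (y - y') * hαβ
    · intro Y hY
      simp only [Finset.coe_filter, Finset.mem_Ioo, Set.mem_ofPred_eq] at hY
      obtain ⟨⟨hY0, hY1⟩, hY2⟩ := hY
      have hdm := Int.emod_add_mul_ediv (-k * Y) D
      have hlo := Int.emod_nonneg (-k * Y) hD.ne'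
      have hne : (-k * Y) % D ≠ 0 := by
        intro h
        have h2 : D ∣ k * Y := by
          have := Int.dvd_of_emod_eq_zero h
          rwa [neg_mul, dvd_neg] at this
        exact absurd (Int.le_of_dvd hY0 (hkD.symm.dvd_of_dvd_mul_left h2)) (by omega)
      generalize (-k * Y) / D = e at *
      generalize (-k * Y) % D = s at *
      have hB : u₁ * (-e * u₂ + Y * α) - u₂ * (-e * u₁ - Y * β) = Y := by
        linear_combination Y * hαβ
      have hA' : (-e * u₁ - Y * β) * v₂ - (-e * u₂ + Y * α) * v₁ = s := by
        rw [hA, hB]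
        linear_combination -hdm - D * e * hαβ
      refine ⟨(-e * u₁ - Y * β, -e * u₂ + Y * α), ⟨?_, ?_, ?_⟩, hB⟩
      · simp only [hA']; omega
      · simp only [hB]; omega
      · simp only [hA', hB]; omega
  rw [hint] at hbij
  rw [← hbij] at hcard
  obtain rfl : D = 15 := by
    rw [← hcard]; norm_num
  have h3 : ¬ (3 : ℤ) ∣ k := fun h =>
    absurd (hkD.isUnit_of_dvd' h (by norm_num)) (by rw [Int.isUnit_iff]; norm_num)
  have h5 : ¬ (5 : ℤ) ∣ k := fun h =>
    absurd (hkD.isUnit_of_dvd' h (by norm_num)) (by rw [Int.isUnit_iff]; norm_num)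
  have h3' : ¬ (3 : ℤ) ∣ k - 1 := fun h =>
    absurd (hkD1.isUnit_of_dvd' h (by norm_num)) (by rw [Int.isUnit_iff]; norm_num)
  have h5' : ¬ (5 : ℤ) ∣ k - 1 := fun h =>
    absurd (hkD1.isUnit_of_dvd' h (by norm_num)) (by rw [Int.isUnit_iff]; norm_num)
  have hres : k % 15 = 2 ∨ k % 15 = 8 ∨ k % 15 = 14 := by omega
  have hkm : k = k % 15 + 15 * (k / 15) := (Int.emod_add_mul_ediv k 15).symm
  have hA'' : ∀ x y : ℤ, x * v₂ - y * v₁ = 15 * (α * x + β * y - k / 15 * (u₁ * y - u₂ * x))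
      - k % 15 * (u₁ * y - u₂ * x) := by
    intro x y
    rw [hA]
    linear_combination -(u₁ * y - u₂ * x) * hkm
  rcases hres with h | h | h
  · refine ⟨1, 2, 15, by simp, fun x y h1 h2 h3 => ?_⟩
    have := hA'' x y
    rw [h] at this
    omega
  · refine ⟨2, 1, 15, by simp, fun x y h1 h2 h3 => ?_⟩
    have := hA'' x y
    rw [h] at this
    omega
  · refine ⟨1, -1, 0, by simp, fun x y h1 h2 h3 => ?_⟩
    have := hA'' x y
    rw [h] at this
    omega

theorem collinear_of_area_eq_zero {p q r : ℝ × ℝ} (h : area p q r = 0) :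
    Collinear ℝ ({p, q, r} : Set (ℝ × ℝ)) := by
  by_cases hpq : p = q
  · subst hpq
    simpa using collinear_pair ℝ p r
  · refine collinear_of_linear_eq (a := q.2 - p.2) (b := p.1 - q.1)
      (c := (q.2 - p.2) * p.1 + (p.1 - q.1) * p.2) ?_ ?_
    · by_contra! hc
      exact hpq (Prod.ext (by linarith [hc.2]) (by linarith [hc.1]))
    · unfold area at h
      rintro z (rfl | rfl | rfl)
      · rfl
      · ring
      · linear_combination -h

/-- The case of positively oriented vertices. -/
theorem collinear_interior_of_area_pos {p q r : ℝ × ℝ} (hp : LatticePt p) (hq : LatticePt q)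
    (hr : LatticePt r) (hdim : ¬ Collinear ℝ ({p, q, r} : Set (ℝ × ℝ)))
    (hpos : 0 < area p q r)
    (hbd : (latticePts (frontier (convexHull ℝ ({p, q, r} : Set (ℝ × ℝ))))).ncard = 3)
    (hint : (latticePts (interior (convexHull ℝ ({p, q, r} : Set (ℝ × ℝ))))).ncard = 7) :
    Collinear ℝ (latticePts (interior (convexHull ℝ ({p, q, r} : Set (ℝ × ℝ))))) := by
  have hmem := mem_triangle_iff hdim hpos
  have hmemi := mem_interior_triangle_iff hdim hpos
  have hclosed : IsClosed (convexHull ℝ ({p, q, r} : Set (ℝ × ℝ))) :=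
    (Set.toFinite {p, q, r}).isClosed_convexHull ℝ
  have hfr : ∀ z, z ∈ frontier (convexHull ℝ ({p, q, r} : Set (ℝ × ℝ))) ↔
      (0 ≤ area p z r ∧ 0 ≤ area p q z ∧ area p z r + area p q z ≤ area p q r) ∧
      (area p z r = 0 ∨ area p q z = 0 ∨ area p z r + area p q z = area p q r) := by
    intro z
    rw [hclosed.frontier_eq, Set.mem_sdiff, hmem, hmemi]
    constructor
    · rintro ⟨⟨h1, h2, h3⟩, h4⟩
      refine ⟨⟨h1, h2, h3⟩, ?_⟩
      by_contra! hc
      exact h4 ⟨lt_of_le_of_ne h1 hc.1.symm, lt_of_le_of_ne h2 hc.2.1.symm,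
        lt_of_le_of_ne h3 hc.2.2⟩
    · rintro ⟨h, h4⟩
      refine ⟨h, ?_⟩
      rintro ⟨h1, h2, h3⟩
      rcases h4 with h4 | h4 | h4 <;> linarith
  have hverts : latticePts (frontier (convexHull ℝ ({p, q, r} : Set (ℝ × ℝ)))) = {p, q, r} := by
    symm
    refine Set.eq_of_subset_of_ncard_le ?_ ?_ (Set.finite_of_ncard_ne_zero (by rw [hbd]; simp))
    · have e1 : area p p r = 0 := by unfold area; ring
      have e2 : area p q p = 0 := by unfold area; ring
      have e3 : area p q q = 0 := by unfold area; ring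
      have e4 : area p r r = 0 := by unfold area; ring
      rintro z (rfl | rfl | rfl)
      · refine ⟨(hfr _).2 ?_, hp⟩
        simp [e1, e2, hpos.le]
      · refine ⟨(hfr _).2 ?_, hq⟩
        simp [e3, hpos.le]
      · refine ⟨(hfr _).2 ?_, hr⟩
        simp [e4, hpos.le]
    · rw [hbd, ← triangleBasis_range p q r hdim, ← Set.image_univ,
        Set.ncard_image_of_injective _ (triangleBasis p q r hdim).ind.injective]
      simp
  obtain ⟨p₁, p₂, rfl⟩ := hp
  obtain ⟨q₁, q₂, rfl⟩ := hq
  obtain ⟨r₁, r₂, rfl⟩ := hr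
  set P : ℝ × ℝ := ((p₁ : ℝ), (p₂ : ℝ)) with hP
  set Q : ℝ × ℝ := ((q₁ : ℝ), (q₂ : ℝ)) with hQ
  set R : ℝ × ℝ := ((r₁ : ℝ), (r₂ : ℝ)) with hR
  let φ : ℤ × ℤ → ℝ × ℝ := fun z => (((p₁ + z.1 : ℤ) : ℝ), ((p₂ + z.2 : ℤ) : ℝ))
  have hφ : Function.Injective φ := by
    rintro ⟨x, y⟩ ⟨x', y'⟩ h
    simpa [φ] using h
  have hφlat : ∀ z, LatticePt (φ z) := fun z => ⟨_, _, rfl⟩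
  have hsurj : ∀ z, LatticePt z → ∃ w, φ w = z := by
    rintro z ⟨m, n, rfl⟩
    exact ⟨(m - p₁, n - p₂), by simp [φ]⟩
  set D : ℤ := (q₁ - p₁) * (r₂ - p₂) - (q₂ - p₂) * (r₁ - p₁) with hDdef
  have hDa : area P Q R = (D : ℝ) := by simp [area, hP, hQ, hR, hDdef]
  have hAa : ∀ x y : ℤ, area P (φ (x, y)) R =
      ((x * (r₂ - p₂) - y * (r₁ - p₁) : ℤ) : ℝ) := by
    intro x y
    simp [area, hP, hR, φ]
  have hBa : ∀ x y : ℤ, area P Q (φ (x, y)) =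
      (((q₁ - p₁) * y - (q₂ - p₂) * x : ℤ) : ℝ) := by
    intro x y
    simp [area, hP, hQ, φ]
  have hi : ∀ x y : ℤ, φ (x, y) ∈ interior (convexHull ℝ {P, Q, R}) ↔
      0 < x * (r₂ - p₂) - y * (r₁ - p₁) ∧ 0 < (q₁ - p₁) * y - (q₂ - p₂) * x ∧
      x * (r₂ - p₂) - y * (r₁ - p₁) + ((q₁ - p₁) * y - (q₂ - p₂) * x) < D := by
    intro x y
    rw [hmemi, hAa, hBa, hDa]
    norm_cast
  have hlat : latticePts (interior (convexHull ℝ {P, Q, R})) =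
      φ '' {z : ℤ × ℤ | 0 < z.1 * (r₂ - p₂) - z.2 * (r₁ - p₁) ∧
        0 < (q₁ - p₁) * z.2 - (q₂ - p₂) * z.1 ∧
        z.1 * (r₂ - p₂) - z.2 * (r₁ - p₁) + ((q₁ - p₁) * z.2 - (q₂ - p₂) * z.1) < D} := by
    ext z
    constructor
    · rintro ⟨hz, hl⟩
      obtain ⟨⟨x, y⟩, rfl⟩ := hsurj z hl
      exact ⟨(x, y), (hi x y).1 hz, rfl⟩
    · rintro ⟨⟨x, y⟩, hz, rfl⟩
      exact ⟨(hi x y).2 hz, hφlat _⟩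
  have hDpos : 0 < D := by
    rw [hDa] at hpos
    exact_mod_cast hpos
  obtain ⟨a, b, c, hab, hmed⟩ := lattice_triangle_median hDdef hDpos (by
    intro x y h1 h2 h3 h4
    have hz : φ (x, y) ∈ latticePts (frontier (convexHull ℝ {P, Q, R})) := by
      refine ⟨(hfr _).2 ?_, hφlat _⟩
      rw [hAa, hBa, hDa]
      norm_cast
    rw [hverts] at hz
    simp only [Set.mem_insert_iff, Set.mem_singleton_iff, hP, hQ, hR, φ, Prod.mk.injEq,
      Int.cast_inj] at hz
    omega) (by rw [← Set.ncard_image_of_injective _ hφ, ← hlat, hint])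
  rw [hlat]
  refine collinear_of_linear_eq (a := a * (r₂ - p₂) - b * (q₂ - p₂))
    (b := b * (q₁ - p₁) - a * (r₁ - p₁))
    (c := c + (a * (r₂ - p₂) - b * (q₂ - p₂)) * p₁ + (b * (q₁ - p₁) - a * (r₁ - p₁)) * p₂) ?_ ?_
  · by_contra! hc
    obtain ⟨hc1, hc2⟩ := hc
    norm_cast at hc1 hc2
    have ha : a * D = 0 := by
      rw [hDdef]; linear_combination (q₁ - p₁) * hc1 + (q₂ - p₂) * hc2
    have hb : b * D = 0 := by
      rw [hDdef]; linear_combination (r₁ - p₁) * hc1 + (r₂ - p₂) * hc2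
    rcases hab with h | h
    · exact (mul_ne_zero h hDpos.ne') ha
    · exact (mul_ne_zero h hDpos.ne') hb
  · rintro _ ⟨⟨x, y⟩, ⟨h1, h2, h3⟩, rfl⟩
    have := hmed x y h1 h2 h3
    have hcast : (a : ℝ) * (x * (r₂ - p₂) - y * (r₁ - p₁)) +
        b * ((q₁ - p₁) * y - (q₂ - p₂) * x) = c := by exact_mod_cast this
    simp only [φ]
    push_cast
    linear_combination hcast

/-- Every lattice triangle with exactly three boundary lattice points and exactly `7`
interior lattice points has all of its interior lattice points collinear. -/
theorem stmt9 (p q r : ℝ × ℝ) (hp : LatticePt p) (hq : LatticePt q) (hr : LatticePt r)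
    (hdim : ¬ Collinear ℝ ({p, q, r} : Set (ℝ × ℝ)))
    (T : Set (ℝ × ℝ)) (hT : T = convexHull ℝ ({p, q, r} : Set (ℝ × ℝ)))
    (hbd : (latticePts (frontier T)).ncard = 3)
    (hint : (latticePts (interior T)).ncard = 7) :
    Collinear ℝ (latticePts (interior T)) := by
  subst hT
  rcases lt_trichotomy (area p q r) 0 with h | h | h
  · have hswap : ({p, q, r} : Set (ℝ × ℝ)) = {p, r, q} := by
      rw [Set.pair_comm]
    rw [hswap] at hdim hbd hint ⊢
    refine collinear_interior_of_area_pos hp hr hq hdim ?_ hbd hint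
    unfold area at h ⊢
    linarith
  · exact absurd (collinear_of_area_eq_zero h) hdim
  · exact collinear_interior_of_area_pos hp hq hr hdim h hbd hint
end
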